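/- arXiv:1909.03565 — 9 statements merged into one kernel-verified Lean document; each statement's English description precedes it below -/
import Mathlib

section
/- Let m ≥ 1 and let D be a finite set of pairwise distinct points in ℤ^m. Suppose there exist a point D_p ∈ D and a coordinate j ∈ {1,…,m} such that D_p(j) < D_q(j) for every other point D_q ∈ D (i.e., D_p is the unique minimum in direction j). Then there exists a PMI sequence of pairwise distinct points of D of maximum length whose first term is D_p; equivalently, the maximum length of a PMI sequence of pairwise distinct points of D that starts with D_p equals the maximum length over all PMI sequences of pairwise distinct points of D. -/
/-- A sequence `f` of `δ` pairwise distinct points in `ℤ^m` is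
pseudo-monotonically increasing (PMI) if for every index `i` there is a
coordinate `j` such that the `j`-th coordinate of `f i` is strictly less than
the `j`-th coordinate of every later term. -/
def IsPMI {m δ : ℕ} (f : Fin δ → Fin m → ℤ) : Prop :=
  Function.Injective f ∧
    ∀ i : Fin δ, ∃ j : Fin m, ∀ i' : Fin δ, i < i' → f i j < f i' j

/-- If `p ∈ D` is the unique minimum of `D` in some direction `j`, then the
maximum length of a PMI sequence of points of `D` starting with `p` equals the
maximum length of a PMI sequence of points of `D`. -/
theorem stmt0 (m : ℕ) (hm : 1 ≤ m) (D : Finset (Fin m → ℤ))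
    (p : Fin m → ℤ) (hp : p ∈ D) (j : Fin m)
    (hmin : ∀ q ∈ D, q ≠ p → p j < q j) :
    sSup {δ : ℕ | ∃ f : Fin δ → Fin m → ℤ, IsPMI f ∧ (∀ i, f i ∈ D) ∧
        ∀ h : 0 < δ, f ⟨0, h⟩ = p}
      = sSup {δ : ℕ | ∃ f : Fin δ → Fin m → ℤ, IsPMI f ∧ ∀ i, f i ∈ D} := by
  congr 1
  ext δ
  constructor
  · rintro ⟨f, h1, h2, _⟩
    exact ⟨f, h1, h2⟩
  · rintro ⟨f, ⟨hinj, hpmi⟩, hD⟩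
    cases δ with
    | zero => exact ⟨f, ⟨hinj, hpmi⟩, hD, fun h => absurd h (lt_irrefl 0)⟩
    | succ n =>
      obtain ⟨k, hk⟩ : ∃ k : Fin (n + 1), ∀ i : Fin n, f (k.succAbove i) ≠ p := by
        by_cases h : ∃ k, f k = p
        · obtain ⟨k, hk⟩ := h
          exact ⟨k, fun i hi => Fin.succAbove_ne k i (hinj (hi.trans hk.symm))⟩
        · exact ⟨0, fun i hi => h ⟨_, hi⟩⟩
      refine ⟨Fin.cons p (fun i => f (k.succAbove i)), ⟨?_, ?_⟩, ?_, fun h => rfl⟩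
      · rw [Fin.cons_injective_iff]
        refine ⟨?_, fun a b hab => Fin.succAbove_right_injective (hinj hab)⟩
        rintro ⟨i, hi⟩
        exact hk i hi
      · intro i
        refine Fin.cases ?_ (fun i => ?_) i
        · refine ⟨j, fun i' => Fin.cases (fun h => absurd h (lt_irrefl _)) (fun i' _ => ?_) i'⟩
          simp only [Fin.cons_zero, Fin.cons_succ]
          exact hmin _ (hD _) (hk i')
        · obtain ⟨l, hl⟩ := hpmi (k.succAbove i)
          refine ⟨l, fun i' => Fin.cases (fun h => absurd h (Fin.not_lt_zero _)) (fun i' h => ?_) i'⟩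
          simp only [Fin.cons_succ]
          exact hl _ (Fin.strictMono_succAbove k (Fin.succ_lt_succ_iff.1 h))
      · intro i
        refine Fin.cases ?_ (fun i => ?_) i
        · simpa using hp
        · simpa using hD _
end

section
/- Let m ≥ 1 and let X ⊆ ℤ^m be a conflict with c-partition X_1, …, X_m. Then every PMI sequence of pairwise distinct points of ℤ^m contains at most |X| − min(|X_1|, |X_2|, …, |X_m|) + 1 terms belonging to X. -/
/-- `X` is a conflict with c-partition `P 1, …, P m`: `X` is the union of the
parts, each part has more than one element, all points of the `i`-th part share
the same `i`-th coordinate, and this coordinate is at most the `i`-th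
coordinate of every point of `X` outside the `i`-th part. -/
def IsConflict {m : ℕ} (X : Finset (Fin m → ℤ)) (P : Fin m → Finset (Fin m → ℤ)) : Prop :=
  X = Finset.univ.biUnion P ∧ (∀ i, 1 < (P i).card) ∧
    ∀ i : Fin m, ∀ p ∈ P i, ∀ q ∈ X,
      (q ∈ P i → p i = q i) ∧ (q ∉ P i → p i ≤ q i)

/-- Any PMI sequence of pairwise distinct points of `ℤ^m` contains at most
`|X| - min_i |X_i| + 1` terms belonging to a conflict `X` with c-partition
`X_1, …, X_m`. -/
theorem stmt1 (m : ℕ) (hm : 1 ≤ m) (X : Finset (Fin m → ℤ))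
    (P : Fin m → Finset (Fin m → ℤ)) (hX : IsConflict X P)
    (δ : ℕ) (f : Fin δ → Fin m → ℤ) (hf : IsPMI f) :
    (Finset.univ.filter fun i : Fin δ => f i ∈ X).card
      ≤ X.card
        - (Finset.univ.inf' (Finset.univ_nonempty_iff.mpr ⟨⟨0, hm⟩⟩)
            fun i => (P i).card) + 1 := by
  obtain ⟨hU, -, hC⟩ := hX
  obtain ⟨hinj, hmono⟩ := hf
  set S := Finset.univ.filter fun i : Fin δ => f i ∈ X with hS
  rcases S.eq_empty_or_nonempty with h0 | hne
  · rw [h0]; simp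
  have hi := S.min'_mem hne
  set i := S.min' hne with hi_def
  obtain ⟨j, hj⟩ := hmono i
  have hPX : P j ⊆ X := by
    rw [hU]; exact Finset.subset_biUnion_of_mem P (Finset.mem_univ j)
  have hiX : f i ∈ X := by
    have := hi
    rw [hS, Finset.mem_filter] at this
    exact this.2
  have hsub : (S.erase i).image f ⊆ X \ P j := by
    intro q hq
    obtain ⟨k, hk, rfl⟩ := Finset.mem_image.mp hq
    obtain ⟨hki, hkS⟩ := Finset.mem_erase.mp hk
    have hkX : f k ∈ X := by
      rw [hS, Finset.mem_filter] at hkS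
      exact hkS.2
    have hlt : i < k := lt_of_le_of_ne (S.min'_le k hkS) (Ne.symm hki)
    have h1 := hj k hlt
    refine Finset.mem_sdiff.mpr ⟨hkX, fun hkP => ?_⟩
    have h2 := hC j (f k) hkP (f i) hiX
    by_cases h : f i ∈ P j
    · have := h2.1 h
      omega
    · have := h2.2 h
      omega
  have hcard := Finset.card_le_card hsub
  rw [Finset.card_image_of_injective _ hinj, Finset.card_erase_of_mem hi,
    Finset.card_sdiff_of_subset hPX] at hcard
  have hinf := Finset.inf'_le (fun i => (P i).card) (Finset.mem_univ j)
  have := Nat.sub_le_sub_left hinf X.card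
  omega
end

section
/- Let m ≥ 1, let D be a finite set of pairwise distinct points in ℤ^m, and let c = (c_1,…,c_m) ∈ ℤ^m. Then α(c) = max over i ∈ {1,…,m} of ( α(c + e_i) + 1_{c_i} ), where c + e_i is obtained from c by increasing the i-th entry by 1, and 1_{c_i} equals 1 if there exists a point p ∈ D with p(i) = c_i and p(j) ≥ c_j for all j ≠ i, and equals 0 otherwise. -/
/-- `alpha D c` is the maximum length of a PMI sequence of pairwise distinct
points of `D` all of whose terms are coordinatewise at least `c`. -/
noncomputable def alpha {m : ℕ} (D : Finset (Fin m → ℤ)) (c : Fin m → ℤ) : ℕ :=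
  sSup {δ : ℕ | ∃ f : Fin δ → Fin m → ℤ, IsPMI f ∧ (∀ i, f i ∈ D) ∧
    ∀ i j, c j ≤ f i j}

theorem alpha_bdd {m : ℕ} (D : Finset (Fin m → ℤ)) (c : Fin m → ℤ) :
    BddAbove {δ : ℕ | ∃ f : Fin δ → Fin m → ℤ, IsPMI f ∧ (∀ i, f i ∈ D) ∧
    ∀ i j, c j ≤ f i j} := by
  refine ⟨D.card, ?_⟩
  rintro δ ⟨f, hf, hD, -⟩
  have := Finset.card_le_card_of_injOn (s := (Finset.univ : Finset (Fin δ))) (t := D) f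
    (fun i _ => hD i) hf.1.injOn
  simpa using this

theorem alpha_attained {m : ℕ} (D : Finset (Fin m → ℤ)) (c : Fin m → ℤ) :
    ∃ f : Fin (alpha D c) → Fin m → ℤ, IsPMI f ∧ (∀ i, f i ∈ D) ∧
    ∀ i j, c j ≤ f i j := by
  have := Nat.sSup_mem (s := {δ : ℕ | ∃ f : Fin δ → Fin m → ℤ, IsPMI f ∧ (∀ i, f i ∈ D) ∧
    ∀ i j, c j ≤ f i j}) ⟨0, fun i => i.elim0, ⟨fun i => i.elim0, fun i => i.elim0⟩,
      fun i => i.elim0, fun i => i.elim0⟩ (alpha_bdd D c)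
  exact this

theorem le_alpha {m δ : ℕ} {D : Finset (Fin m → ℤ)} {c : Fin m → ℤ}
    (f : Fin δ → Fin m → ℤ) (h : IsPMI f) (hD : ∀ i, f i ∈ D)
    (hc : ∀ i j, c j ≤ f i j) : δ ≤ alpha D c :=
  le_csSup (alpha_bdd D c) ⟨f, h, hD, hc⟩

open Classical in
/-- The dynamic-programming recurrence:
`α(c) = max_{1 ≤ i ≤ m} ( α(c + e_i) + 1_{c_i} )`, where `1_{c_i} = 1` iff
there is a point `p ∈ D` with `p i = c i` and `p j ≥ c j` for all `j ≠ i`. -/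
theorem stmt2 (m : ℕ) (hm : 1 ≤ m) (D : Finset (Fin m → ℤ)) (c : Fin m → ℤ) :
    alpha D c
      = Finset.univ.sup' (Finset.univ_nonempty_iff.mpr ⟨⟨0, hm⟩⟩)
          (fun i : Fin m =>
            alpha D (Function.update c i (c i + 1))
              + if (∃ p ∈ D, p i = c i ∧ ∀ j, j ≠ i → c j ≤ p j) then 1 else 0) := by
  apply le_antisymm
  · obtain ⟨f, hf, hD, hc⟩ := alpha_attained D c
    generalize alpha D c = δ at f hf hD hc
    cases δ with
    | zero => exact Nat.zero_le _
    | succ n =>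
      obtain ⟨j, hj⟩ := hf.2 0
      refine le_trans ?_ (Finset.le_sup' _ (Finset.mem_univ j))
      by_cases h0 : f 0 j = c j
      · rw [if_pos ⟨f 0, hD 0, h0, fun k _ => hc 0 k⟩]
        apply Nat.succ_le_succ
        refine le_alpha (fun i => f i.succ) ⟨fun a b hab => ?_, fun i => ?_⟩
          (fun i => hD _) (fun i k => ?_)
        · exact Fin.succ_injective _ (hf.1 hab)
        · obtain ⟨k, hk⟩ := hf.2 i.succ
          exact ⟨k, fun i' h => hk _ (Fin.succ_lt_succ_iff.mpr h)⟩
        · by_cases hk : k = j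
          · subst hk
            have := hj i.succ (Fin.succ_pos i)
            simp only [Function.update_self]
            omega
          · simpa [Function.update_of_ne hk] using hc i.succ k
      · refine le_trans (le_alpha f hf hD (fun i k => ?_)) (Nat.le_add_right _ _)
        by_cases hk : k = j
        · subst hk
          have h1 := hc 0 k
          simp only [Function.update_self]
          rcases eq_or_ne i 0 with rfl | hi
          · omega
          · have := hj i (Fin.pos_of_ne_zero hi)
            omega
        · simpa [Function.update_of_ne hk] using hc i k
  · refine Finset.sup'_le _ _ (fun j _ => ?_)
    obtain ⟨f, hf, hD, hc⟩ := alpha_attained D (Function.update c j (c j + 1))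
    generalize alpha D (Function.update c j (c j + 1)) = δ at f hf hD hc
    have hc' : ∀ i k, c k ≤ f i k := by
      intro i k
      have := hc i k
      by_cases hk : k = j
      · subst hk
        simp only [Function.update_self] at this
        omega
      · simpa [Function.update_of_ne hk] using this
    have hcj : ∀ i, c j < f i j := by
      intro i
      have := hc i j
      simp only [Function.update_self] at this
      omega
    split_ifs with hp
    · obtain ⟨p, hpD, hpj, hpc⟩ := hp
      refine le_alpha (Fin.cons p f : Fin (δ + 1) → Fin m → ℤ) ⟨?_, fun i => ?_⟩
        (fun i => ?_) (fun i k => ?_)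
      · refine Fin.cons_injective_iff.mpr ⟨?_, hf.1⟩
        rintro ⟨i, rfl⟩
        have := hcj i
        omega
      · refine Fin.cases ?_ (fun i => ?_) i
        · refine ⟨j, fun i' => ?_⟩
          refine Fin.cases (fun h => absurd h (lt_irrefl _)) (fun i' _ => ?_) i'
          simp only [Fin.cons_zero, Fin.cons_succ]
          rw [hpj]
          exact hcj i'
        · obtain ⟨k, hk⟩ := hf.2 i
          refine ⟨k, fun i' => ?_⟩
          refine Fin.cases (fun h => absurd h (Fin.not_lt_zero _)) (fun i' h => ?_) i'
          simp only [Fin.cons_succ]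
          exact hk i' (Fin.succ_lt_succ_iff.mp h)
      · refine Fin.cases ?_ (fun i => ?_) i
        · simpa using hpD
        · simpa using hD i
      · refine Fin.cases ?_ (fun i => ?_) i
        · simp only [Fin.cons_zero]
          by_cases hk : k = j
          · subst hk
            exact hpj.ge
          · exact hpc k hk
        · simpa using hc' i k
    · exact le_alpha f hf hD hc'
end

section
/- Let m ≥ 1 and let D be a set of n pairwise distinct points in ℤ^m. If there exists a PMI sequence of length n consisting of all the points of D, then no subset X ⊆ D is a conflict (i.e., D contains no conflict). -/
/-- If a set `D` of `n` pairwise distinct points in `ℤ^m` admits a PMI sequence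
of length `n` consisting of all of its points, then no subset of `D` is a
conflict. -/
theorem stmt8 (m n : ℕ) (hm : 1 ≤ m) (D : Finset (Fin m → ℤ)) (hD : D.card = n)
    (f : Fin n → Fin m → ℤ) (hf : IsPMI f) (hrange : ∀ i, f i ∈ D)
    (hall : ∀ p ∈ D, ∃ i, f i = p) :
    ∀ X ⊆ D, ∀ P : Fin m → Finset (Fin m → ℤ), ¬ IsConflict X P := by
  rintro X hX P ⟨hXP, hcard, hP⟩
  have hsub : ∀ j, ∀ p ∈ P j, p ∈ X := by
    intro j p hp
    rw [hXP]
    exact Finset.mem_biUnion.2 ⟨j, Finset.mem_univ _, hp⟩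
  have hne : (Finset.univ.filter (fun i => f i ∈ X)).Nonempty := by
    obtain ⟨p, hp⟩ := Finset.card_pos.1 (lt_trans Nat.zero_lt_one (hcard ⟨0, hm⟩))
    have hpX := hsub _ p hp
    obtain ⟨i, rfl⟩ := hall p (hX hpX)
    exact ⟨i, by simpa using hpX⟩
  obtain ⟨i, hi, hmin⟩ := Finset.exists_min_image _ id hne
  have hiX : f i ∈ X := by simpa using hi
  obtain ⟨j, hj⟩ := hf.2 i
  obtain ⟨p, hp, hpi⟩ := Finset.exists_mem_ne (hcard j) (f i)
  have hpX := hsub j p hp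
  obtain ⟨k, rfl⟩ := hall p (hX hpX)
  have hik : i ≤ k := hmin k (by simpa using hpX)
  have hlt : i < k := lt_of_le_of_ne hik (fun h => hpi (by rw [h]))
  have h1 := hj k hlt
  have h2 := hP j _ hp _ hiX
  by_cases h : f i ∈ P j
  · have := h2.1 h
    omega
  · have := h2.2 h
    omega
end

section
/- Let G be the path graph on n ≥ 1 vertices and let V_ℓ be a set of m leader nodes with 1 ≤ m ≤ n. If the number of connected components of the induced subgraph G^{−V_ℓ} on the non-leader vertices is strictly less than m + 1, then there exists a PMI sequence of distance-to-leader vectors of length n (an ordering of all n vertices forming a PMI sequence). -/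
/-- A sequence `f` of `δ` pairwise distinct nodes of `G` is a PMI sequence of
distance-to-leader vectors with leader set `L`. -/
def IsPMISeq {V : Type*} (G : SimpleGraph V) (L : Finset V) {δ : ℕ}
    (f : Fin δ → V) : Prop :=
  Function.Injective f ∧
    ∀ i : Fin δ, ∃ ℓ ∈ L, ∀ i' : Fin δ, i < i' →
      G.dist ℓ (f i) < G.dist ℓ (f i')

open SimpleGraph in
lemma pmi_walk_le {n : ℕ} {u v : Fin n} (p : (pathGraph n).Walk u v) :
    (u.val ≤ v.val + p.length) ∧ (v.val ≤ u.val + p.length) := by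
  induction p with
  | nil => simp
  | cons h p ih =>
    rw [pathGraph_adj] at h
    rw [Walk.length_cons]
    omega

open SimpleGraph in
lemma pmi_exists_walk {n : ℕ} (k : ℕ) : ∀ u v : Fin n, u.val + k = v.val →
    ∃ p : (pathGraph n).Walk u v, p.length = k := by
  induction k with
  | zero =>
    intro u v h
    obtain rfl : u = v := Fin.ext (by omega)
    exact ⟨Walk.nil, rfl⟩
  | succ k ih =>
    intro u v h
    have hv := v.isLt
    obtain ⟨p, hp⟩ := ih ⟨u.val + 1, by omega⟩ v (by simp only; omega)
    refine ⟨Walk.cons ?_ p, by rw [Walk.length_cons, hp]⟩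
    rw [pathGraph_adj]
    exact Or.inl rfl

open SimpleGraph in
lemma pmi_dist_le {n : ℕ} (u v : Fin n) (h : u.val ≤ v.val) :
    (pathGraph n).dist u v = v.val - u.val := by
  obtain ⟨p, hp⟩ := pmi_exists_walk (v.val - u.val) u v (by omega)
  have h1 := (pathGraph n).dist_le p
  obtain ⟨q, hq⟩ := (Walk.reachable p).exists_walk_length_eq_dist
  have := pmi_walk_le q
  omega

open SimpleGraph in
lemma pmi_dist {n : ℕ} (u v : Fin n) :
    (pathGraph n).dist u v = (v.val - u.val) + (u.val - v.val) := by
  rcases le_total u.val v.val with h | h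
  · rw [pmi_dist_le u v h]; omega
  · rw [SimpleGraph.dist_comm, pmi_dist_le v u h]; omega

open SimpleGraph in
lemma pmi_of_key {n : ℕ} (L : Finset (Fin n)) (key : Fin n → ℕ)
    (hk : Function.Injective key)
    (H : ∀ u, ∃ l ∈ L, ∀ v, key u < key v →
      (v.val - l.val) + (l.val - v.val) > (u.val - l.val) + (l.val - u.val)) :
    ∃ f : Fin n → Fin n, Function.Bijective f ∧ IsPMISeq (pathGraph n) L f := by
  refine ⟨Tuple.sort key, (Tuple.sort key).bijective, (Tuple.sort key).injective, fun i => ?_⟩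
  obtain ⟨l, hl, h⟩ := H (Tuple.sort key i)
  refine ⟨l, hl, fun j hij => ?_⟩
  rw [pmi_dist, pmi_dist]
  apply h
  have hs : StrictMono (key ∘ Tuple.sort key) :=
    (Tuple.monotone_sort key).strictMono_of_injective (hk.comp (Tuple.sort key).injective)
  exact hs hij

open SimpleGraph in
lemma pmi_comp {n : ℕ} (hn : 1 ≤ n) (L : Finset (Fin n))
    (h0 : ∀ l ∈ L, l.val ≠ 0) (h1 : ∀ l ∈ L, l.val + 1 ≠ n)
    (h2 : ∀ l ∈ L, ∀ l' ∈ L, l.val + 1 ≠ l'.val) :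
    L.card + 1 ≤ Nat.card (SimpleGraph.induce ((↑L : Set (Fin n))ᶜ)
          (SimpleGraph.pathGraph n)).ConnectedComponent := by
  set G := SimpleGraph.induce ((↑L : Set (Fin n))ᶜ) (SimpleGraph.pathGraph n) with hG
  let S : ((↑L : Set (Fin n))ᶜ : Set (Fin n)) → Finset (Fin n) := fun x => L.filter (· < x.1)
  have hadj : ∀ x y, G.Adj x y → S x = S y := by
    intro x y h
    have h' : (pathGraph n).Adj x.1 y.1 := h
    rw [pathGraph_adj] at h'
    ext l
    simp only [S, Finset.mem_filter, Fin.lt_def]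
    refine and_congr_right fun hl => ?_
    have hx : l.val ≠ x.1.val := fun e => x.2 (by rw [← Fin.ext e]; exact hl)
    have hy : l.val ≠ y.1.val := fun e => y.2 (by rw [← Fin.ext e]; exact hl)
    omega
  have hwalk : ∀ x y, G.Reachable x y → S x = S y := by
    rintro x y ⟨p⟩
    induction p with
    | nil => rfl
    | cons h p ih => exact (hadj _ _ h).trans ih
  let g : Option L → ((↑L : Set (Fin n))ᶜ : Set (Fin n)) := fun o =>
    match o with
    | none => ⟨⟨0, hn⟩, fun h => h0 _ h rfl⟩
    | some l => ⟨⟨l.1.val + 1, by have := h1 _ l.2; have := l.1.isLt; omega⟩,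
        fun h => h2 _ l.2 _ h rfl⟩
  have hinj : Function.Injective (fun o => G.connectedComponentMk (g o)) := by
    intro a b hab
    have hS := hwalk _ _ (ConnectedComponent.exact hab)
    have key : ∀ l, l ∈ S (g a) ↔ l ∈ S (g b) := fun l => by rw [hS]
    rcases a with _ | a <;> rcases b with _ | b
    · rfl
    · have := (key b.1).2
      simp only [S, g, Finset.mem_filter, Fin.lt_def, b.2, true_and] at this
      omega
    · have := (key a.1).1
      simp only [S, g, Finset.mem_filter, Fin.lt_def, a.2, true_and] at this
      omega
    · have e1 := (key b.1).2
      have e2 := (key a.1).1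
      simp only [S, g, Finset.mem_filter, Fin.lt_def, a.2, b.2, true_and] at e1 e2
      congr 1
      exact Subtype.ext (Fin.ext (by omega))
  have : Finite G.ConnectedComponent := Quot.finite _
  have := Nat.card_le_card_of_injective _ hinj
  simpa using this

/-- If the path graph on `n` vertices with leader set `V_ℓ` of size `m`
(`1 ≤ m ≤ n`) is such that the subgraph induced on the non-leader vertices has
fewer than `m + 1` connected components, then there is a PMI sequence of
distance-to-leader vectors of length `n` (an ordering of all `n` vertices). -/
theorem stmt10 (n : ℕ) (hn : 1 ≤ n) (Vl : Finset (Fin n)) (m : ℕ)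
    (hm : Vl.card = m) (hm1 : 1 ≤ m) (hmn : m ≤ n)
    (hcomp : Nat.card
        (SimpleGraph.induce ((↑Vl : Set (Fin n))ᶜ)
          (SimpleGraph.pathGraph n)).ConnectedComponent < m + 1) :
    ∃ f : Fin n → Fin n, Function.Bijective f ∧
      IsPMISeq (SimpleGraph.pathGraph n) Vl f := by
  by_cases h0 : ∀ l ∈ Vl, l.val ≠ 0
  · by_cases h1 : ∀ l ∈ Vl, l.val + 1 ≠ n
    · by_cases h2 : ∀ l ∈ Vl, ∀ l' ∈ Vl, l.val + 1 ≠ l'.val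
      · have := pmi_comp hn Vl h0 h1 h2
        omega
      · push Not at h2
        obtain ⟨a, ha, b, hb, hab⟩ := h2
        refine pmi_of_key Vl (fun v => if v.val ≤ a.val then 2 * (a.val - v.val)
          else 2 * (v.val - b.val) + 1) ?_ ?_
        · intro u v huv
          simp only at huv
          apply Fin.ext
          split_ifs at huv <;> omega
        · intro u
          by_cases hu : u.val ≤ a.val
          · refine ⟨a, ha, fun v hv => ?_⟩
            split_ifs at hv; all_goals omega
          · refine ⟨b, hb, fun v hv => ?_⟩
            split_ifs at hv; all_goals omega
    · push Not at h1
      obtain ⟨l, hl, e⟩ := h1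
      refine pmi_of_key Vl (fun v => n - v.val) ?_ ?_
      · intro u v huv
        simp only at huv
        exact Fin.ext (by omega)
      · intro u
        refine ⟨l, hl, fun v hv => ?_⟩
        omega
  · push Not at h0
    obtain ⟨l, hl, e⟩ := h0
    refine pmi_of_key Vl (fun v => v.val) Fin.val_injective fun u => ⟨l, hl, fun v hv => ?_⟩
    omega
end

section
/- Let G be the path graph on n ≥ 1 vertices and let V_ℓ be a set of m leader nodes with 1 ≤ m ≤ n. If the induced subgraph G^{−V_ℓ} on the non-leader vertices has exactly m + 1 connected components, and a is the number of vertices of a smallest connected component of G^{−V_ℓ}, then there exists a PMI sequence of distance-to-leader vectors of length n − a. -/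
theorem pg_lower {n : ℕ} {u v : Fin n} (p : (SimpleGraph.pathGraph n).Walk u v) :
    (u : ℕ) ≤ v + p.length ∧ (v : ℕ) ≤ u + p.length := by
  induction p with
  | nil => simp
  | cons h p ih =>
    rw [SimpleGraph.pathGraph_adj] at h
    simp only [SimpleGraph.Walk.length_cons]
    omega

theorem pg_walk {n : ℕ} (k : ℕ) : ∀ (u v : Fin n), (u : ℕ) + k = v →
    ∃ p : (SimpleGraph.pathGraph n).Walk u v, p.length = k := by
  induction k with
  | zero =>
    intro u v h
    obtain rfl : u = v := Fin.ext (by omega)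
    exact ⟨SimpleGraph.Walk.nil, rfl⟩
  | succ k ih =>
    intro u v h
    have hlt : (u : ℕ) + 1 < n := by omega
    obtain ⟨p, hp⟩ := ih ⟨u + 1, hlt⟩ v (by simp; omega)
    have hadj : (SimpleGraph.pathGraph n).Adj u ⟨u + 1, hlt⟩ := by
      rw [SimpleGraph.pathGraph_adj]; left; rfl
    exact ⟨SimpleGraph.Walk.cons hadj p, by simp [hp]⟩

theorem pg_dist_le {n : ℕ} (u v : Fin n) (h : (u : ℕ) ≤ v) :
    (SimpleGraph.pathGraph n).dist u v = v - u := by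
  obtain ⟨p, hp⟩ := pg_walk ((v : ℕ) - u) u v (by omega)
  have h1 := SimpleGraph.dist_le p
  obtain ⟨q, hq⟩ := p.reachable.exists_walk_length_eq_dist
  have := pg_lower q
  omega

theorem pg_dist {n : ℕ} (u v : Fin n) :
    (SimpleGraph.pathGraph n).dist u v = (v - u : ℕ) + (u - v : ℕ) := by
  rcases le_total (u : ℕ) v with h | h
  · rw [pg_dist_le u v h]; omega
  · rw [SimpleGraph.dist_comm, pg_dist_le v u h]; omega

theorem pmi_cons {n k : ℕ} (L : Finset (Fin n)) (f : Fin k → Fin n)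
    (hf : IsPMISeq (SimpleGraph.pathGraph n) L f) (v l : Fin n) (hl : l ∈ L)
    (h : ∀ i, (SimpleGraph.pathGraph n).dist l v < (SimpleGraph.pathGraph n).dist l (f i)) :
    IsPMISeq (SimpleGraph.pathGraph n) L (Fin.cons v f : Fin (k + 1) → Fin n) := by
  refine ⟨?_, ?_⟩
  · rw [Fin.cons_injective_iff]
    refine ⟨?_, hf.1⟩
    rintro ⟨i, hi⟩
    have := h i
    rw [hi] at this
    exact lt_irrefl _ this
  · intro i
    refine Fin.cases ?_ (fun i => ?_) i
    · refine ⟨l, hl, fun i' => ?_⟩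
      refine Fin.cases (fun h => absurd h (lt_irrefl _)) (fun i' _ => ?_) i'
      simpa using h i'
    · obtain ⟨l', hl', h'⟩ := hf.2 i
      refine ⟨l', hl', fun i' => ?_⟩
      refine Fin.cases (fun h => absurd h (by simp)) (fun i' hi => ?_) i'
      simpa using h' i' (by simpa using hi)

theorem pmi_main {n : ℕ} (L : Finset (Fin n)) (c d : ℕ) (hcd : c < d) (hdn : d ≤ n)
    (hc : 0 < c → ∃ l ∈ L, (l : ℕ) + 1 = c) (hd : d < n → ∃ l ∈ L, (l : ℕ) = d) (k : ℕ) :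
    ∀ x y : ℕ, x ≤ c → d ≤ y → y ≤ n → k + y = n + x →
    ∃ f : Fin k → Fin n, IsPMISeq (SimpleGraph.pathGraph n) L f ∧
      ∀ i, (f i : ℕ) < x ∨ y ≤ f i := by
  induction k with
  | zero =>
    intro x y _ _ _ _
    exact ⟨Fin.elim0, ⟨fun i => i.elim0, fun i => i.elim0⟩, fun i => i.elim0⟩
  | succ k ih =>
    intro x y hx hy hyn hk
    have key : (0 < x ∧ ∃ l ∈ L, x ≤ (l : ℕ) + 1 ∧ (y = n ∨ (l : ℕ) + l + 1 < x + y)) ∨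
        (y < n ∧ ∃ l ∈ L, (l : ℕ) ≤ y ∧ (x = 0 ∨ x + y < (l : ℕ) + l + 1)) := by
      by_cases hx0 : 0 < x
      · obtain ⟨l, hl, hlc⟩ := hc (by omega)
        by_cases hyn' : y < n
        · obtain ⟨l', hl', hld⟩ := hd (by omega)
          by_cases hh : (l : ℕ) + l + 1 < x + y
          · exact Or.inl ⟨hx0, l, hl, by omega, Or.inr hh⟩
          · exact Or.inr ⟨hyn', l', hl', by omega, Or.inr (by omega)⟩
        · exact Or.inl ⟨hx0, l, hl, by omega, Or.inl (by omega)⟩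
      · obtain ⟨l', hl', hld⟩ := hd (by omega)
        exact Or.inr ⟨by omega, l', hl', by omega, Or.inl (by omega)⟩
    rcases key with ⟨hx0, l, hl, h1, h2⟩ | ⟨hy0, l, hl, h1, h2⟩
    · obtain ⟨f, hf, hr⟩ := ih (x - 1) y (by omega) hy hyn (by omega)
      refine ⟨Fin.cons ⟨x - 1, by omega⟩ f, pmi_cons L f hf _ l hl ?_, ?_⟩
      · intro i
        have := hr i
        have := (f i).2
        rw [pg_dist, pg_dist]
        simp only
        omega
      · intro i
        refine Fin.cases ?_ (fun i => ?_) i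
        · simp; omega
        · have := hr i
          simp only [Fin.cons_succ]; omega
    · obtain ⟨f, hf, hr⟩ := ih x (y + 1) (by omega) (by omega) (by omega) (by omega)
      refine ⟨Fin.cons ⟨y, by omega⟩ f, pmi_cons L f hf _ l hl ?_, ?_⟩
      · intro i
        have := hr i
        rw [pg_dist, pg_dist]
        simp only
        omega
      · intro i
        refine Fin.cases ?_ (fun i => ?_) i
        · simp
        · have := hr i
          simp only [Fin.cons_succ]; omega

theorem run_reach {n : ℕ} (L : Finset (Fin n)) (k : ℕ) :
    ∀ (u v : Fin n) (hu : u ∈ ((↑L : Set (Fin n))ᶜ)) (hv : v ∈ ((↑L : Set (Fin n))ᶜ)),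
    (u : ℕ) + k = v → (∀ w : Fin n, u ≤ w → w ≤ v → w ∉ L) →
    (SimpleGraph.induce ((↑L : Set (Fin n))ᶜ) (SimpleGraph.pathGraph n)).Reachable
      ⟨u, hu⟩ ⟨v, hv⟩ := by
  induction k with
  | zero =>
    intro u v hu hv h _
    obtain rfl : u = v := Fin.ext (by omega)
    exact SimpleGraph.Reachable.refl _
  | succ k ih =>
    intro u v hu hv h hw
    have hlt : (u : ℕ) + 1 < n := by omega
    have hw1 : (⟨u + 1, hlt⟩ : Fin n) ∉ L :=
      hw _ (by simp [Fin.le_def]) (by simp [Fin.le_def]; omega)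
    have := ih ⟨u + 1, hlt⟩ v (fun hh => hw1 (Finset.mem_coe.1 hh)) hv (by simp; omega)
      (fun w h1 h2 => hw w (by rw [Fin.le_def] at h1 ⊢; simp only at h1; omega) h2)
    refine SimpleGraph.Reachable.trans (SimpleGraph.Adj.reachable ?_) this
    simp [SimpleGraph.pathGraph_adj]

theorem stmt11 (n : ℕ) (hn : 1 ≤ n) (Vl : Finset (Fin n)) (m : ℕ)
    (hm : Vl.card = m) (hm1 : 1 ≤ m) (hmn : m ≤ n)
    (hcomp : Nat.card
        (SimpleGraph.induce ((↑Vl : Set (Fin n))ᶜ)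
          (SimpleGraph.pathGraph n)).ConnectedComponent = m + 1)
    (a : ℕ)
    (ha : IsLeast {k : ℕ | ∃ c : (SimpleGraph.induce ((↑Vl : Set (Fin n))ᶜ)
          (SimpleGraph.pathGraph n)).ConnectedComponent,
        Nat.card c.supp = k} a) :
    ∃ f : Fin (n - a) → Fin n,
      IsPMISeq (SimpleGraph.pathGraph n) Vl f := by
  obtain ⟨⟨C, hC⟩, -⟩ := ha
  obtain ⟨⟨v, hv⟩, hvC⟩ := C.nonempty_supp
  classical
  have hvL : v ∉ Vl := by simpa using hv
  have hex : ∃ d, (v : ℕ) < d ∧ (d < n → ∃ l ∈ Vl, (l : ℕ) = d) :=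
    ⟨n, v.2, fun h => absurd h (lt_irrefl _)⟩
  obtain ⟨d, hd, hdmin⟩ : ∃ d, ((v : ℕ) < d ∧ (d < n → ∃ l ∈ Vl, (l : ℕ) = d)) ∧
      ∀ d' < d, ¬ ((v : ℕ) < d' ∧ (d' < n → ∃ l ∈ Vl, (l : ℕ) = d')) :=
    ⟨Nat.find hex, Nat.find_spec hex, fun d' h => Nat.find_min hex h⟩
  have hdn : d ≤ n := by
    by_contra h
    exact hdmin n (by omega) ⟨v.2, fun h => absurd h (lt_irrefl _)⟩
  have hex2 : ∃ e, e ≤ (v : ℕ) ∧ (0 < v - e → ∃ l ∈ Vl, (l : ℕ) + 1 = v - e) :=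
    ⟨v, le_rfl, fun h => by omega⟩
  obtain ⟨e, he, hemin⟩ : ∃ e, (e ≤ (v : ℕ) ∧ (0 < v - e → ∃ l ∈ Vl, (l : ℕ) + 1 = v - e)) ∧
      ∀ e' < e, ¬ (e' ≤ (v : ℕ) ∧ (0 < v - e' → ∃ l ∈ Vl, (l : ℕ) + 1 = v - e')) :=
    ⟨Nat.find hex2, Nat.find_spec hex2, fun d' h => Nat.find_min hex2 h⟩
  have hrun : ∀ w : Fin n, (v : ℕ) - e ≤ w → (w : ℕ) < d → w ∉ Vl := by
    intro w h1 h2 hw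
    rcases lt_trichotomy (w : ℕ) v with h | h | h
    · exact hemin (v - (w + 1)) (by omega) ⟨by omega, fun _ => ⟨w, hw, by omega⟩⟩
    · exact hvL (by rwa [← Fin.ext h])
    · exact hdmin w h2 ⟨h, fun _ => ⟨w, hw, rfl⟩⟩
  have hmem : ∀ w : Fin n, (v : ℕ) - e ≤ w → (w : ℕ) < d →
      ∃ hw : w ∈ ((↑Vl : Set (Fin n))ᶜ), (⟨w, hw⟩ : ((↑Vl : Set (Fin n))ᶜ : Set (Fin n))) ∈ C.supp := by
    intro w h1 h2
    have hw : w ∈ ((↑Vl : Set (Fin n))ᶜ) := by simpa using hrun w h1 h2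
    refine ⟨hw, ?_⟩
    rw [SimpleGraph.ConnectedComponent.mem_supp_iff] at hvC ⊢
    rw [← hvC, SimpleGraph.ConnectedComponent.eq]
    rcases le_total (w : ℕ) v with h | h
    · exact run_reach Vl (v - w) w v hw hv (by omega)
        (fun z hz1 hz2 => hrun z (by rw [Fin.le_def] at hz1; omega) (by rw [Fin.le_def] at hz2; omega))
    · exact (run_reach Vl (w - v) v w hv hw (by omega)
        (fun z hz1 hz2 => hrun z (by rw [Fin.le_def] at hz1; omega)
          (by rw [Fin.le_def] at hz2; omega))).symm
  have hcard : d - (v - e) ≤ a := by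
    rw [← hC]
    let g : Fin (d - (v - e)) → C.supp := fun i =>
      ⟨⟨⟨(v - e) + i, by omega⟩, (hmem ⟨(v - e) + i, by omega⟩ (by simp) (by simp; omega)).1⟩,
        (hmem ⟨(v - e) + i, by omega⟩ (by simp) (by simp; omega)).2⟩
    have hg : Function.Injective g := by
      intro i j hij
      simp only [g, Subtype.mk.injEq, Fin.mk.injEq] at hij
      exact Fin.ext (by omega)
    have := Nat.card_le_card_of_injective g hg
    simpa using this
  obtain ⟨f, hf, -⟩ := pmi_main Vl (v - e) d (by omega) hdn he.2 hd.2 (n - (d - (v - e)))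
    (v - e) d le_rfl le_rfl hdn (by omega)
  have hle : n - a ≤ n - (d - (v - e)) := by omega
  refine ⟨fun i => f (Fin.castLE hle i), ?_, ?_⟩
  · intro i j hij
    exact Fin.castLE_injective hle (hf.1 hij)
  · intro i
    obtain ⟨l, hl, h⟩ := hf.2 (Fin.castLE hle i)
    exact ⟨l, hl, fun i' hi => h _ hi⟩
end

section
/- Let G be the cycle graph on n ≥ 3 vertices and let V_ℓ be a set of m leader nodes with 2 ≤ m ≤ n. If the number of connected components of the induced subgraph G^{−V_ℓ} on the non-leader vertices is strictly less than m, then there exists a PMI sequence of distance-to-leader vectors of length n (an ordering of all n vertices forming a PMI sequence). -/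
section Aux
open scoped Fin.NatCast Fin.CommRing

open SimpleGraph in
theorem aux_lower (N : ℕ) (a u v : Fin (N+2)) (p : (cycleGraph (N+2)).Walk u v) :
    min (v - a).val (N + 2 - (v - a).val) ≤ min (u - a).val (N + 2 - (u - a).val) + p.length := by
  induction p with
  | nil => simp
  | @cons x y z h p ih =>
    rw [Walk.length_cons]
    have key : ∀ b c : Fin (N+2), c - b = 1 →
        (c.val = b.val + 1 ∨ (c.val = 0 ∧ b.val = N + 1)) := by
      intro b c hbc
      have : c = b + 1 := by rw [← hbc]; abel
      subst this
      have := Fin.val_add_one b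
      split_ifs at this with hl
      · right; subst hl; simp
      · left; exact this
    have h1 : ∀ b c : Fin (N+2), c - b = 1 → (c - a) - (b - a) = 1 := by
      intro b c hbc; rw [← hbc]; abel
    have := (x - a).isLt
    have := (y - a).isLt
    rw [cycleGraph_adj] at h
    rcases h with h | h
    · have := key _ _ (h1 _ _ h); omega
    · have := key _ _ (h1 _ _ h); omega

open SimpleGraph in
theorem aux_upper (N : ℕ) (a : Fin (N+2)) (k : ℕ) :
    (cycleGraph (N+2)).dist a (a + (k : Fin (N+2))) ≤ k := by
  induction k with
  | zero => simp
  | succ k ih =>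
    have hc : (cycleGraph (N+2)).Connected := cycleGraph_connected
    have h1 : (cycleGraph (N+2)).Adj (a + (k : Fin (N+2))) (a + ((k+1 : ℕ) : Fin (N+2))) := by
      rw [cycleGraph_adj]; right; push_cast; abel
    have h2 := dist_eq_one_iff_adj.mpr h1
    have := hc.dist_triangle (u := a) (v := a + (k : Fin (N+2))) (w := a + ((k+1 : ℕ) : Fin (N+2)))
    omega

open SimpleGraph in
theorem aux_dist (N : ℕ) (a : Fin (N+2)) (k : ℕ) (hk : k ≤ N + 2) :
    (cycleGraph (N+2)).dist a (a + (k : Fin (N+2))) = min k (N + 2 - k) := by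
  have hc : (cycleGraph (N+2)).Connected := cycleGraph_connected
  apply le_antisymm
  · apply le_min (aux_upper N a k)
    have := aux_upper N (a + (k : Fin (N+2))) (N + 2 - k)
    rw [add_assoc, ← Nat.cast_add, Nat.add_sub_cancel' hk, Fin.natCast_self, add_zero,
      dist_comm] at this
    exact this
  · obtain ⟨p, hp⟩ := hc.exists_walk_length_eq_dist a (a + (k : Fin (N+2)))
    have := aux_lower N a _ _ p
    rw [hp, add_sub_cancel_left, sub_self, Fin.val_natCast] at this
    rcases hk.lt_or_eq with h | h
    · rw [Nat.mod_eq_of_lt h] at this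
      simpa using this
    · subst h; simp

open SimpleGraph in
theorem aux_seq (N : ℕ) (Vl : Finset (Fin (N+2))) (a : Fin (N+2)) (ha : a ∈ Vl)
    (ha1 : a + 1 ∈ Vl) :
    ∃ f : Fin (N+2) → Fin (N+2), Function.Bijective f ∧ IsPMISeq (cycleGraph (N+2)) Vl f := by
  let f : Fin (N+2) → Fin (N+2) := fun i =>
    a + ((if i.val % 2 = 0 then N + 2 - i.val / 2 else i.val / 2 + 1 : ℕ) : Fin (N+2))
  have hf1 : ∀ i, f i = a + 1 +
      ((if i.val % 2 = 0 then N + 1 - i.val / 2 else i.val / 2 : ℕ) : Fin (N+2)) := by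
    intro i
    have : (if i.val % 2 = 0 then N + 2 - i.val / 2 else i.val / 2 + 1 : ℕ) =
      1 + (if i.val % 2 = 0 then N + 1 - i.val / 2 else i.val / 2 : ℕ) := by
      have := i.isLt
      split_ifs <;> omega
    simp only [f]
    rw [this, Nat.cast_add, Nat.cast_one, add_assoc]
  have d0 : ∀ i : Fin (N+2), (cycleGraph (N+2)).dist a (f i) =
      if i.val % 2 = 0 then i.val / 2 else min (i.val/2+1) (N + 1 - i.val/2) := by
    intro i
    have := i.isLt
    simp only [f]
    rw [aux_dist]
    · split_ifs <;> omega
    · split_ifs <;> omega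
  have d1 : ∀ i : Fin (N+2), (cycleGraph (N+2)).dist (a+1) (f i) =
      if i.val % 2 = 0 then min (i.val/2+1) (N + 1 - i.val/2) else i.val / 2 := by
    intro i
    have := i.isLt
    rw [hf1, aux_dist]
    · split_ifs <;> omega
    · split_ifs <;> omega
  have H : ∀ i, ∃ ℓ ∈ Vl, ∀ i', i < i' →
      (cycleGraph (N+2)).dist ℓ (f i) < (cycleGraph (N+2)).dist ℓ (f i') := by
    intro i
    by_cases hi : i.val % 2 = 0
    · refine ⟨a, ha, fun i' h => ?_⟩
      have h : i.val < i'.val := h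
      have := i'.isLt
      rw [d0, d0]; split_ifs <;> omega
    · refine ⟨a + 1, ha1, fun i' h => ?_⟩
      have h : i.val < i'.val := h
      have := i'.isLt
      rw [d1, d1]; split_ifs <;> omega
  have inj : Function.Injective f := by
    intro i j hij
    rcases lt_trichotomy i j with h | h | h
    · obtain ⟨l, -, hl⟩ := H i
      have := hl j h
      rw [hij] at this; omega
    · exact h
    · obtain ⟨l, -, hl⟩ := H j
      have := hl i h
      rw [hij] at this; omega
  exact ⟨f, Finite.injective_iff_bijective.mp inj, inj, H⟩

open SimpleGraph in
theorem aux_comp (N : ℕ) (Vl : Finset (Fin (N+2))) (hne : Vl.Nonempty)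
    (h : ∀ a ∈ Vl, a + 1 ∉ Vl) :
    Vl.card ≤ Nat.card (induce ((↑Vl : Set (Fin (N+2)))ᶜ)
          (cycleGraph (N+2))).ConnectedComponent := by
  obtain ⟨v, hv⟩ := hne
  have ex : ∀ x : Fin (N+2), ∃ k : ℕ, x - (k : Fin (N+2)) ∈ Vl := by
    intro x
    refine ⟨(x - v).val, ?_⟩
    rw [Fin.cast_val_eq_self]; simpa using hv
  let q : Fin (N+2) → Fin (N+2) := fun x => x - ((Nat.find (ex x) : ℕ) : Fin (N+2))
  have step : ∀ x, x + 1 ∉ Vl → q (x + 1) = q x := by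
    intro x hx
    have : Nat.find (ex (x+1)) = Nat.find (ex x) + 1 := by
      have e : ∃ k : ℕ, x + 1 - ((k + 1 : ℕ) : Fin (N+2)) ∈ Vl := by
        obtain ⟨k, hk⟩ := ex x
        exact ⟨k, by simpa using hk⟩
      rw [Nat.find_comp_succ (ex (x+1)) e (by simpa using hx)]
      congr 1
      apply Nat.find_congr'
      intro k
      simp
    simp only [q]
    rw [this]; simp
  have q0 : ∀ x ∈ Vl, q x = x := by
    intro x hx
    have : Nat.find (ex x) = 0 := by simpa using hx
    simp only [q]; rw [this]; simp
  let G := induce ((↑Vl : Set (Fin (N+2)))ᶜ) (cycleGraph (N+2))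
  have adj : ∀ x y, G.Adj x y → q x.1 = q y.1 := by
    intro x y hxy
    have hxy : (cycleGraph (N+2)).Adj x.1 y.1 := hxy
    have hx : x.1 ∉ Vl := fun hh => x.2 (Finset.mem_coe.mpr hh)
    have hy : y.1 ∉ Vl := fun hh => y.2 (Finset.mem_coe.mpr hh)
    rw [cycleGraph_adj] at hxy
    rcases hxy with e | e
    · have e : x.1 = y.1 + 1 := by rw [← e]; abel
      rw [e] at hx ⊢
      exact step _ hx
    · have e : y.1 = x.1 + 1 := by rw [← e]; abel
      rw [e] at hy ⊢
      exact (step _ hy).symm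
  have reach : ∀ x y, G.Reachable x y → q x.1 = q y.1 := by
    rintro x y ⟨p⟩
    induction p with
    | nil => rfl
    | cons h p ih => exact (adj _ _ h).trans ih
  let F : Vl → G.ConnectedComponent := fun a =>
    G.connectedComponentMk ⟨a.1 + 1, by simpa using h a.1 a.2⟩
  have inj : Function.Injective F := by
    intro a b hab
    have := reach _ _ (ConnectedComponent.exact hab)
    simp only at this
    rw [step _ (h _ a.2), step _ (h _ b.2), q0 _ a.2, q0 _ b.2] at this
    exact Subtype.ext this
  have : Finite G.ConnectedComponent := inferInstance
  have := Nat.card_le_card_of_injective F inj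
  simpa using this

end Aux

theorem stmt12 (n : ℕ) (hn : 3 ≤ n) (Vl : Finset (Fin n)) (m : ℕ)
    (hm : Vl.card = m) (hm1 : 2 ≤ m) (hmn : m ≤ n)
    (hcomp : Nat.card
        (SimpleGraph.induce ((↑Vl : Set (Fin n))ᶜ)
          (SimpleGraph.cycleGraph n)).ConnectedComponent < m) :
    ∃ f : Fin n → Fin n, Function.Bijective f ∧
      IsPMISeq (SimpleGraph.cycleGraph n) Vl f := by
  obtain ⟨N, rfl⟩ : ∃ N, n = N + 2 := ⟨n - 2, by omega⟩
  by_cases h : ∃ a ∈ Vl, a + 1 ∈ Vl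
  · obtain ⟨a, ha, ha1⟩ := h
    exact aux_seq N Vl a ha ha1
  · have := aux_comp N Vl (Finset.card_pos.mp (by omega)) (fun a ha h' => h ⟨a, ha, h'⟩)
    omega
end

section
/- Let G be the cycle graph on n ≥ 3 vertices and let V_ℓ be a set of m leader nodes with 2 ≤ m ≤ n. If the induced subgraph G^{−V_ℓ} on the non-leader vertices has exactly m connected components, and a is the number of vertices of a smallest connected component of G^{−V_ℓ}, then there exists a PMI sequence of distance-to-leader vectors of length n − a. -/
theorem cyc_adj (n : ℕ) (hn : 3 ≤ n) (u v : Fin n) : (SimpleGraph.cycleGraph n).Adj u v ↔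
    (v.val = (u.val+1)%n) ∨ u.val=(v.val+1)%n := by
  rw [SimpleGraph.cycleGraph_adj']
  rw [Fin.sub_def, Fin.sub_def]
  have hu := u.isLt
  have hv := v.isLt
  simp only
  have h1 : ∀ x y : ℕ, x < n → y < n → ((n - y + x) % n = 1 ↔ x = (y+1) % n) := by
    intro x y hx hy
    rcases Nat.lt_or_ge (n - y + x) n with h | h
    · rw [Nat.mod_eq_of_lt h]
      rcases Nat.lt_or_ge (y+1) n with h' | h'
      · rw [Nat.mod_eq_of_lt h']; omega
      · have : y + 1 = n := by omega
        rw [this, Nat.mod_self]; omega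
    · rw [Nat.mod_eq_sub_mod h, Nat.mod_eq_of_lt (by omega)]
      rcases Nat.lt_or_ge (y+1) n with h' | h'
      · rw [Nat.mod_eq_of_lt h']; omega
      · have : y + 1 = n := by omega
        rw [this, Nat.mod_self]; omega
  rw [h1 _ _ hu hv, h1 _ _ hv hu]
  exact or_comm

def cycE (n : ℕ) (hn : 3 ≤ n) (p : Fin n) (i : ℕ) : Fin n :=
  ⟨(p.val + i) % n, Nat.mod_lt _ (by omega)⟩

theorem cycE_adj (n : ℕ) (hn : 3 ≤ n) (p : Fin n) (i : ℕ) :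
    (SimpleGraph.cycleGraph n).Adj (cycE n hn p i) (cycE n hn p (i+1)) := by
  rw [cyc_adj n hn]
  left
  simp [cycE, Nat.add_assoc]

theorem cycE_dist (n : ℕ) (hn : 3 ≤ n) (p : Fin n) (i j : ℕ) :
    (SimpleGraph.cycleGraph n).dist (cycE n hn p i) (cycE n hn p (i+j)) ≤ j := by
  have : ∃ w : (SimpleGraph.cycleGraph n).Walk (cycE n hn p i) (cycE n hn p (i+j)),
      w.length = j := by
    induction j with
    | zero => exact ⟨SimpleGraph.Walk.nil, rfl⟩
    | succ j ih =>
      obtain ⟨w, hw⟩ := ih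
      exact ⟨w.concat (cycE_adj n hn p (i+j)), by simp [hw]⟩
  obtain ⟨w, hw⟩ := this
  exact (SimpleGraph.dist_le w).trans hw.le

theorem cyc_walk (n : ℕ) (hn : 3 ≤ n) (u v : Fin n) (w : (SimpleGraph.cycleGraph n).Walk u v) :
    ∃ z : ℤ, |z| ≤ w.length ∧ (n:ℤ) ∣ (v.val:ℤ) - u.val - z := by
  induction w with
  | nil => exact ⟨0, by simp, by simp⟩
  | @cons a b c h w ih =>
    obtain ⟨z, hz, hd⟩ := ih
    rw [cyc_adj n hn] at h
    have key : ∀ x y : ℕ, x = (y+1) % n → (n:ℤ) ∣ (x:ℤ) - y - 1 := by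
      intro x y h
      have := Int.emod_emod_of_dvd ((y:ℤ)+1) (dvd_refl (n:ℤ))
      have h2 : (x:ℤ) % n = (y+1) % n := by rw [h]; push_cast; exact this
      have := Int.ModEq.dvd (show ((y:ℤ)+1) ≡ x [ZMOD n] from h2.symm)
      rwa [← sub_sub] at this
    rcases h with h | h
    · have := key _ _ h
      refine ⟨z + 1, ?_, ?_⟩
      · rw [SimpleGraph.Walk.length_cons]; push_cast
        rw [abs_le] at *; omega
      · have h3 := dvd_add hd this
        ring_nf at h3 ⊢; exact h3
    · have := key _ _ h
      refine ⟨z - 1, ?_, ?_⟩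
      · rw [SimpleGraph.Walk.length_cons]; push_cast
        rw [abs_le] at *; omega
      · have h3 := dvd_sub hd this
        ring_nf at h3 ⊢; exact h3

theorem cyc_lower (n : ℕ) (hn : 3 ≤ n) (p : Fin n) (i t k : ℕ)
    (h1 : i + k < t) (h2 : t + k < n + i) :
    k < (SimpleGraph.cycleGraph n).dist (cycE n hn p i) (cycE n hn p t) := by
  have hc : (SimpleGraph.cycleGraph n).Connected := by
    obtain ⟨k, rfl⟩ : ∃ k, n = k + 1 := ⟨n-1, by omega⟩
    exact SimpleGraph.cycleGraph_connected
  obtain ⟨w, hw⟩ := hc.exists_walk_length_eq_dist (cycE n hn p i) (cycE n hn p t)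
  obtain ⟨z, hz, hd⟩ := cyc_walk n hn _ _ w
  rw [← hw]
  by_contra hlt
  have hdd : (n:ℤ) ∣ (t:ℤ) - i - z := by
    have e1 : ∀ s : ℕ, (n:ℤ) ∣ ((p.val:ℤ) + s) - ((cycE n hn p s).val : ℤ) := by
      intro s
      simp only [cycE]; push_cast
      exact Int.dvd_self_sub_emod
    have h3 := dvd_add hd (dvd_sub (e1 t) (e1 i))
    ring_nf at h3 ⊢; exact h3
  obtain ⟨c, hc⟩ := hdd
  rw [abs_le] at hz
  rcases le_or_gt c 0 with h | h
  · have : (n:ℤ) * c ≤ 0 := mul_nonpos_of_nonneg_of_nonpos (by positivity) h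
    omega
  · have : (n:ℤ) * 1 ≤ n * c := mul_le_mul_of_nonneg_left h (by positivity)
    omega

theorem cycE_inj (n : ℕ) (hn : 3 ≤ n) (p : Fin n) (i j : ℕ) (h : i ≤ j) (h' : j < i + n)
    (he : cycE n hn p i = cycE n hn p j) : i = j := by
  by_contra hne
  have := cyc_lower n hn p i j 0 (by omega) (by omega)
  rw [he] at this
  simp at this

theorem cycE_add_n (n : ℕ) (hn : 3 ≤ n) (p : Fin n) (i : ℕ) :
    cycE n hn p (i + n) = cycE n hn p i := by
  simp [cycE, ← Nat.add_assoc]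

theorem cycE_add (n : ℕ) (hn : 3 ≤ n) (p : Fin n) (i j : ℕ) :
    cycE n hn (cycE n hn p i) j = cycE n hn p (i + j) := by
  simp [cycE, ← Nat.add_assoc]

theorem cycE_zero (n : ℕ) (hn : 3 ≤ n) (p : Fin n) :
    cycE n hn p 0 = p := by
  ext
  simp [cycE, Nat.mod_eq_of_lt]

theorem cycE_surj (n : ℕ) (hn : 3 ≤ n) (p q : Fin n) :
    ∃ i, i < n ∧ cycE n hn p i = q := by
  refine ⟨(n - p.val + q.val) % n, Nat.mod_lt _ (by omega), ?_⟩
  ext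
  simp only [cycE, Nat.add_mod_mod]
  rw [← Nat.add_assoc, Nat.add_sub_cancel' p.isLt.le, Nat.add_mod_left, Nat.mod_eq_of_lt q.isLt]

theorem cyc_pmi (n : ℕ) (hn : 3 ≤ n) (Vl : Finset (Fin n)) (a d : ℕ) (p : Fin n)
    (hp : p ∈ Vl) (hd0 : 0 < d) (hdn : d < n) (hda : d ≤ a + 1) (hq : cycE n hn p d ∈ Vl) :
    ∃ f : Fin (n - a) → Fin n, IsPMISeq (SimpleGraph.cycleGraph n) Vl f := by
  let t : ℕ → ℕ := fun i => if i % 2 = 0 then n - i / 2 else d + i / 2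
  have te : ∀ i, i % 2 = 0 → t i = n - i / 2 := fun i h => if_pos h
  have tod : ∀ i, ¬ i % 2 = 0 → t i = d + i / 2 := fun i h => if_neg h
  refine ⟨fun i => cycE n hn p (t i), ?_, ?_⟩
  · intro i j hij
    have hi := i.isLt
    have hj := j.isLt
    simp only at hij
    ext
    have ht : t i = t j := by
      have b : ∀ i : ℕ, i < n - a → d ≤ t i ∧ t i ≤ n := by
        intro i hi
        by_cases h : i % 2 = 0
        · rw [te i h]; omega
        · rw [tod i h]; omega
      have b1 := b i hi
      have b2 := b j hj
      rcases le_total (t i) (t j) with h | h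
      · exact cycE_inj n hn p _ _ h (by omega) hij
      · exact (cycE_inj n hn p _ _ h (by omega) hij.symm).symm
    by_cases h : (i:ℕ) % 2 = 0 <;> by_cases h' : (j:ℕ) % 2 = 0
    · rw [te _ h, te _ h'] at ht; omega
    · rw [te _ h, tod _ h'] at ht; omega
    · rw [tod _ h, te _ h'] at ht; omega
    · rw [tod _ h, tod _ h'] at ht; omega
  · intro i
    have hi := i.isLt
    by_cases h : (i:ℕ) % 2 = 0
    · refine ⟨p, hp, fun j hij => ?_⟩
      have hj := j.isLt
      have hij' : (i:ℕ) < j := hij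
      have u := cycE_dist n hn p (t i) ((i:ℕ)/2)
      rw [te _ h] at u
      rw [show n - (i:ℕ)/2 + (i:ℕ)/2 = 0 + n by omega, cycE_add_n, cycE_zero,
        SimpleGraph.dist_comm, ← te _ h] at u
      have hb : 0 + (i:ℕ)/2 < t j ∧ t j + (i:ℕ)/2 < n + 0 := by
        by_cases h' : (j:ℕ) % 2 = 0
        · rw [te _ h']; omega
        · rw [tod _ h']; omega
      have l := cyc_lower n hn p 0 (t j) ((i:ℕ)/2) hb.1 hb.2
      rw [cycE_zero] at l
      exact lt_of_le_of_lt u l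
    · refine ⟨_, hq, fun j hij => ?_⟩
      have hj := j.isLt
      have hij' : (i:ℕ) < j := hij
      have u := cycE_dist n hn p d ((i:ℕ)/2)
      rw [← tod _ h] at u
      have hb : d + (i:ℕ)/2 < t j ∧ t j + (i:ℕ)/2 < n + d := by
        by_cases h' : (j:ℕ) % 2 = 0
        · rw [te _ h']; omega
        · rw [tod _ h']; omega
      exact lt_of_le_of_lt u (cyc_lower n hn p d (t j) ((i:ℕ)/2) hb.1 hb.2)

/-- If the subgraph of the cycle graph on `n` vertices induced on the
non-leader vertices has exactly `m` connected components, where `m` is the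
number of leaders (`2 ≤ m ≤ n`), and `a` is the number of vertices of a
smallest connected component of that induced subgraph, then there is a PMI
sequence of distance-to-leader vectors of length `n - a`. -/
theorem stmt13 (n : ℕ) (hn : 3 ≤ n) (Vl : Finset (Fin n)) (m : ℕ)
    (hm : Vl.card = m) (hm1 : 2 ≤ m) (hmn : m ≤ n)
    (hcomp : Nat.card
        (SimpleGraph.induce ((↑Vl : Set (Fin n))ᶜ)
          (SimpleGraph.cycleGraph n)).ConnectedComponent = m)
    (a : ℕ)
    (ha : IsLeast {k : ℕ | ∃ c : (SimpleGraph.induce ((↑Vl : Set (Fin n))ᶜ)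
          (SimpleGraph.cycleGraph n)).ConnectedComponent,
        Nat.card c.supp = k} a) :
    ∃ f : Fin (n - a) → Fin n,
      IsPMISeq (SimpleGraph.cycleGraph n) Vl f := by
  classical
  obtain ⟨⟨c, hc⟩, -⟩ := ha
  obtain ⟨⟨v, hv⟩, hvc⟩ := c.nonempty_supp
  have hv' : v ∉ Vl := by simpa using hv
  obtain ⟨p0, hp0, q0, hq0, hne⟩ := Finset.one_lt_card.mp (show 1 < Vl.card by omega)
  -- nearest leader on the left
  have hex : ∃ l, ∃ p ∈ Vl, cycE n hn p l = v := by
    obtain ⟨l, -, hl⟩ := cycE_surj n hn p0 v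
    exact ⟨l, p0, hp0, hl⟩
  obtain ⟨p, hp, hpl⟩ := Nat.find_spec hex
  have hmin := fun l h => Nat.find_min hex (m := l) h
  generalize Nat.find hex = l at *
  have hex2 : ∃ d, 0 < d ∧ cycE n hn p d ∈ Vl := by
    exact ⟨n, by omega, by have h := cycE_add_n n hn p 0; rw [Nat.zero_add, cycE_zero] at h; rw [h]; exact hp⟩
  obtain ⟨hd0, hq⟩ := Nat.find_spec hex2
  have hmin2 := fun l h => Nat.find_min hex2 (m := l) h
  generalize Nat.find hex2 = d at *
  have hdn : d < n := by
    obtain ⟨q, hqV, hqp⟩ : ∃ q ∈ Vl, q ≠ p := by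
      by_cases h : p0 = p
      · exact ⟨q0, hq0, by rw [← h]; exact hne.symm⟩
      · exact ⟨p0, hp0, h⟩
    obtain ⟨i, hi, hiq⟩ := cycE_surj n hn p q
    by_contra hd
    refine hmin2 i (by omega) ⟨?_, by rw [hiq]; exact hqV⟩
    rcases Nat.eq_zero_or_pos i with h | h
    · subst h; rw [cycE_zero] at hiq; exact absurd hiq.symm hqp
    · exact h
  have hl0 : 0 < l := by
    rcases Nat.eq_zero_or_pos l with h | h
    · subst h; rw [cycE_zero] at hpl; subst hpl; exact absurd hp hv'
    · exact h
  have hld : l < d := by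
    by_contra h
    refine hmin (l - d) (by omega) ⟨_, hq, ?_⟩
    rw [cycE_add, ← hpl]; congr 1; omega
  have hnon : ∀ i, 0 < i → i < d → cycE n hn p i ∈ ((↑Vl : Set (Fin n))ᶜ) := by
    intro i h0 h1 h2
    exact hmin2 i h1 ⟨h0, by simpa using h2⟩
  have hreach : ∀ i (h0 : 0 < i) (h1 : i < d),
      (SimpleGraph.induce ((↑Vl : Set (Fin n))ᶜ) (SimpleGraph.cycleGraph n)).Reachable
        ⟨cycE n hn p 1, hnon 1 (by omega) (by omega)⟩ ⟨cycE n hn p i, hnon i h0 h1⟩ := by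
    intro i h0
    induction i, h0 using Nat.le_induction with
    | base => intro h1; exact SimpleGraph.Reachable.refl _
    | succ i h0 ih =>
      intro h1
      refine (ih (by omega)).trans (SimpleGraph.Adj.reachable ?_)
      exact cycE_adj n hn p i
  have hmem : ∀ i (h0 : 0 < i) (h1 : i < d),
      (⟨cycE n hn p i, hnon i h0 h1⟩ : ((↑Vl : Set (Fin n))ᶜ : Set (Fin n))) ∈ c.supp := by
    intro i h0 h1
    rw [SimpleGraph.ConnectedComponent.mem_supp_iff] at hvc ⊢
    rw [← hvc, SimpleGraph.ConnectedComponent.eq]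
    have := (hreach i h0 h1).symm.trans (hreach l hl0 hld)
    convert this using 2
    exact hpl.symm
  have hcard : d - 1 ≤ a := by
    rw [← hc, ← Nat.card_fin (d-1)]
    refine Nat.card_le_card_of_injective
      (fun i : Fin (d-1) => (⟨_, hmem (i.val+1) (by omega) (by omega)⟩ : c.supp)) ?_
    intro i j hij
    simp only [Subtype.mk.injEq] at hij
    ext
    rcases le_total (i:ℕ) j with h | h
    · have := cycE_inj n hn p _ _ (by omega) (by omega) hij
      omega
    · have := cycE_inj n hn p _ _ (by omega) (by omega) hij.symm
      omega
  exact cyc_pmi n hn Vl a d p hp hd0 hdn (by omega) hq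
end

section
/- Let G be the path graph on n ≥ 1 vertices and let V_ℓ be a set of m leader nodes with 2 ≤ m ≤ n. Let a = min{ d(ℓ, ℓ') : ℓ, ℓ' ∈ V_ℓ, ℓ ≠ ℓ' } be the smallest graph distance between any two distinct leaders. Then there exists a PMI sequence of distance-to-leader vectors of length at least n − a. -/
theorem aux_walk_le {n : ℕ} {u v : Fin n} (w : (SimpleGraph.pathGraph n).Walk u v) :
    (v : ℕ) ≤ u + w.length ∧ (u : ℕ) ≤ v + w.length := by
  induction w with
  | nil => simp
  | cons h p ih =>
    rw [SimpleGraph.pathGraph_adj] at h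
    simp only [SimpleGraph.Walk.length_cons]
    omega

theorem aux_exists_walk {n : ℕ} (k : ℕ) : ∀ (u v : Fin n), (u : ℕ) + k = v →
    ∃ w : (SimpleGraph.pathGraph n).Walk u v, w.length = k := by
  induction k with
  | zero =>
    intro u v h
    have : u = v := Fin.ext (by omega)
    subst this
    exact ⟨SimpleGraph.Walk.nil, rfl⟩
  | succ k ih =>
    intro u v h
    have hv := v.2
    obtain ⟨w, hw⟩ := ih ⟨u + 1, by omega⟩ v (by show (u : ℕ) + 1 + k = v; omega)
    have hadj : (SimpleGraph.pathGraph n).Adj u ⟨u + 1, by omega⟩ := by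
      rw [SimpleGraph.pathGraph_adj]
      left; rfl
    exact ⟨SimpleGraph.Walk.cons hadj w, by rw [SimpleGraph.Walk.length_cons, hw]⟩

theorem aux_dist_add {n : ℕ} (k : ℕ) (u v : Fin n) (h : (u : ℕ) + k = v) :
    (SimpleGraph.pathGraph n).dist u v = k := by
  obtain ⟨w, hw⟩ := aux_exists_walk k u v h
  have h1 := SimpleGraph.dist_le w
  obtain ⟨w', hw'⟩ := w.reachable.exists_walk_length_eq_dist
  have := aux_walk_le w'
  omega

theorem aux_dist_s14 {n : ℕ} (u v : Fin n) :
    (SimpleGraph.pathGraph n).dist u v = ((v : ℕ) - u) + (u - v) := by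
  rcases le_total (u : ℕ) v with h | h
  · rw [aux_dist_add ((v : ℕ) - u) u v (by omega)]; omega
  · rw [SimpleGraph.dist_comm, aux_dist_add ((u : ℕ) - v) v u (by omega)]; omega

theorem aux_sort {V : Type*} (S : Finset V) (K : V → ℕ) (hK : Set.InjOn K S) :
    ∃ f : Fin S.card → V, (∀ i, f i ∈ S) ∧ ∀ i j, i < j → K (f i) < K (f j) := by
  have hc : (S.image K).card = S.card := Finset.card_image_of_injOn hK
  have hex : ∀ i : Fin S.card, ∃ v ∈ S, K v = (S.image K).orderEmbOfFin hc i := fun i => by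
    exact Finset.mem_image.1 (Finset.orderEmbOfFin_mem (S.image K) hc i)
  choose f hf1 hf2 using hex
  refine ⟨f, hf1, fun i j hij => ?_⟩
  rw [hf2, hf2]
  exact ((S.image K).orderEmbOfFin hc).strictMono hij

theorem aux_main (n : ℕ) (Vl : Finset (Fin n)) (p q : Fin n) (hp : p ∈ Vl) (hq : q ∈ Vl)
    (hpq : (p : ℕ) < q) : ∃ δ : ℕ, n - ((q : ℕ) - p) ≤ δ ∧ ∃ f : Fin δ → Fin n,
      IsPMISeq (SimpleGraph.pathGraph n) Vl f := by
  let S : Finset (Fin n) := (Finset.Ioo p q)ᶜ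
  have hS : ∀ v, v ∈ S ↔ ((v : ℕ) ≤ p ∨ (q : ℕ) ≤ v) := by
    intro v
    simp only [S, Finset.mem_compl, Finset.mem_Ioo, Fin.lt_def]
    omega
  have hcard : S.card = n - ((q : ℕ) - p - 1) := by
    simp [S, Finset.card_compl]
  let K : Fin n → ℕ := fun v => if (v : ℕ) ≤ p then 2 * (p - v) else 2 * (v - q) + 1
  have hK : Set.InjOn K S := by
    intro u hu v hv h
    have hu' := (hS u).1 hu
    have hv' := (hS v).1 hv
    apply Fin.ext
    simp only [K] at h
    split_ifs at h <;> omega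
  obtain ⟨f, hf, hmono⟩ := aux_sort S K hK
  refine ⟨S.card, by omega, f, ?_, ?_⟩
  · intro i j hij
    by_contra hne
    rcases lt_or_gt_of_ne hne with h | h
    · have := hmono _ _ h
      rw [hij] at this; omega
    · have := hmono _ _ h
      rw [hij] at this; omega
  · intro i
    have hi := (hS _).1 (hf i)
    by_cases hl : (f i : ℕ) ≤ p
    · refine ⟨p, hp, fun j hij => ?_⟩
      have hj := (hS _).1 (hf j)
      have h := hmono i j hij
      simp only [K] at h
      rw [aux_dist_s14, aux_dist_s14]
      split_ifs at h <;> omega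
    · refine ⟨q, hq, fun j hij => ?_⟩
      have hj := (hS _).1 (hf j)
      have h := hmono i j hij
      simp only [K] at h
      rw [aux_dist_s14, aux_dist_s14]
      split_ifs at h <;> omega

/-- For the path graph on `n ≥ 1` vertices with leader set `V_ℓ` of size `m`
(`2 ≤ m ≤ n`), if `a` is the smallest graph distance between any two distinct
leaders, then there is a PMI sequence of distance-to-leader vectors of length
at least `n - a`. -/
theorem stmt14 (n : ℕ) (hn : 1 ≤ n) (Vl : Finset (Fin n)) (m : ℕ)
    (hm : Vl.card = m) (hm1 : 2 ≤ m) (hmn : m ≤ n) (a : ℕ)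
    (ha : IsLeast {k : ℕ | ∃ x ∈ Vl, ∃ y ∈ Vl, x ≠ y ∧
        (SimpleGraph.pathGraph n).dist x y = k} a) :
    ∃ δ : ℕ, n - a ≤ δ ∧ ∃ f : Fin δ → Fin n,
      IsPMISeq (SimpleGraph.pathGraph n) Vl f := by
  obtain ⟨x, hx, y, hy, hxy, hd⟩ := ha.1
  rw [aux_dist_s14] at hd
  have hne : (x : ℕ) ≠ y := fun h => hxy (Fin.ext h)
  rcases lt_or_gt_of_ne hne with h | h
  · obtain ⟨δ, h1, h2⟩ := aux_main n Vl x y hx hy h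
    exact ⟨δ, by omega, h2⟩
  · obtain ⟨δ, h1, h2⟩ := aux_main n Vl y x hy hx h
    exact ⟨δ, by omega, h2⟩
end
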